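/- Let q, r : ℝ² → ℂ be infinitely differentiable functions of (x, t) and let η ∈ ℂ. Set M = [[η, q],[r, −η]] and N_3 = [[4η³ − 2η q r + q r_x − q_x r, 4η² q + 2η q_x + q_{xx} − 2q²r],[4η² r − 2η r_x + r_{xx} − 2q r², −4η³ + 2η q r − q r_x + q_x r]]. Then the zero curvature equation ∂_t M − ∂_x N_3 + M N_3 − N_3 M = 0 holds at every point of ℝ² if and only if q_t = q_{xxx} − 6 q r q_x and r_t = r_{xxx} − 6 q r r_x hold at every point of ℝ². -/

import Mathlib

/-- Partial derivative in the first (spatial) variable `x`. -/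
noncomputable def pdx (f : ℝ → ℝ → ℂ) : ℝ → ℝ → ℂ := fun x t => deriv (fun x' => f x' t) x

/-- Partial derivative in the second (temporal) variable `t`. -/
noncomputable def pdt (f : ℝ → ℝ → ℂ) : ℝ → ℝ → ℂ := fun x t => deriv (fun t' => f x t') t

/-- Entrywise partial `x`-derivative of a matrix-valued function. -/
noncomputable def mpdx (F : ℝ → ℝ → Matrix (Fin 2) (Fin 2) ℂ) :
    ℝ → ℝ → Matrix (Fin 2) (Fin 2) ℂ :=
  fun x t => Matrix.of fun i j => deriv (fun x' => F x' t i j) x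

/-- Entrywise partial `t`-derivative of a matrix-valued function. -/
noncomputable def mpdt (F : ℝ → ℝ → Matrix (Fin 2) (Fin 2) ℂ) :
    ℝ → ℝ → Matrix (Fin 2) (Fin 2) ℂ :=
  fun x t => Matrix.of fun i j => deriv (fun t' => F x t' i j) t

/-- The AKNS spectral matrix `M = [[η, q],[r, −η]]`. -/
noncomputable def AKNSM (η : ℂ) (q r : ℝ → ℝ → ℂ) : ℝ → ℝ → Matrix (Fin 2) (Fin 2) ℂ :=
  fun x t => !![η, q x t; r x t, -η]

/-- The third AKNS time part
`N₃ = [[4η³ − 2ηqr + qr_x − q_x r, 4η²q + 2ηq_x + q_{xx} − 2q²r],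
      [4η²r − 2ηr_x + r_{xx} − 2qr², −4η³ + 2ηqr − qr_x + q_x r]]`. -/
noncomputable def AKNSN3 (η : ℂ) (q r : ℝ → ℝ → ℂ) : ℝ → ℝ → Matrix (Fin 2) (Fin 2) ℂ :=
  fun x t =>
    !![4 * η ^ 3 - 2 * η * q x t * r x t + q x t * pdx r x t - pdx q x t * r x t,
        4 * η ^ 2 * q x t + 2 * η * pdx q x t + pdx (pdx q) x t - 2 * q x t ^ 2 * r x t;
       4 * η ^ 2 * r x t - 2 * η * pdx r x t + pdx (pdx r) x t - 2 * q x t * r x t ^ 2,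
        -(4 * η ^ 3) + 2 * η * q x t * r x t - q x t * pdx r x t + pdx q x t * r x t]

open scoped ContDiff

theorem ContDiff.slice_left {f : ℝ → ℝ → ℂ} (hf : ContDiff ℝ ∞ fun p : ℝ × ℝ => f p.1 p.2)
    (t : ℝ) : ContDiff ℝ ∞ fun x => f x t :=
  hf.comp (contDiff_id.prodMk contDiff_const)

theorem ContDiff.hasDerivAt_pdx {f : ℝ → ℝ → ℂ} {t : ℝ} (hf : ContDiff ℝ ∞ fun x => f x t)
    (x : ℝ) : HasDerivAt (fun x => f x t) (pdx f x t) x :=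
  (hf.differentiable (by simp) x).hasDerivAt

theorem ContDiff.pdx_slice {f : ℝ → ℝ → ℂ} {t : ℝ} (hf : ContDiff ℝ ∞ fun x => f x t) :
    ContDiff ℝ ∞ fun x => pdx f x t :=
  (contDiff_infty_iff_deriv.1 hf).2

/-- The zero curvature expression is off-diagonal, with the two evolution equations as entries. -/
theorem AKNS3_zero_curvature_eq (η : ℂ) (q r : ℝ → ℝ → ℂ) (x t : ℝ)
    (hq : ContDiff ℝ ∞ fun x => q x t) (hr : ContDiff ℝ ∞ fun x => r x t) :
    mpdt (AKNSM η q r) x t - mpdx (AKNSN3 η q r) x t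
        + AKNSM η q r x t * AKNSN3 η q r x t
        - AKNSN3 η q r x t * AKNSM η q r x t =
      !![0, pdt q x t - (pdx (pdx (pdx q)) x t - 6 * q x t * r x t * pdx q x t);
        pdt r x t - (pdx (pdx (pdx r)) x t - 6 * q x t * r x t * pdx r x t), 0] := by
  have q₀ := hq.hasDerivAt_pdx x
  have q₁ := hq.pdx_slice.hasDerivAt_pdx x
  have q₂ := hq.pdx_slice.pdx_slice.hasDerivAt_pdx x
  have r₀ := hr.hasDerivAt_pdx x
  have r₁ := hr.pdx_slice.hasDerivAt_pdx x
  have r₂ := hr.pdx_slice.pdx_slice.hasDerivAt_pdx x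
  have d₁₁ := (((q₀.const_mul (2 * η)).mul r₀).const_sub (4 * η ^ 3) |>.add (q₀.mul r₁)).sub
    (q₁.mul r₀) |>.deriv
  have d₁₂ := (((q₀.const_mul (4 * η ^ 2)).add (q₁.const_mul (2 * η))).add q₂).sub
    (((q₀.pow 2).const_mul 2).mul r₀) |>.deriv
  have d₂₁ := (((r₀.const_mul (4 * η ^ 2)).sub (r₁.const_mul (2 * η))).add r₂).sub
    ((q₀.const_mul 2).mul (r₀.pow 2)) |>.deriv
  have d₂₂ := (((q₀.const_mul (2 * η)).mul r₀).const_add (-(4 * η ^ 3)) |>.sub (q₀.mul r₁)).add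
    (q₁.mul r₀) |>.deriv
  have hM : mpdt (AKNSM η q r) x t = !![0, pdt q x t; pdt r x t, 0] := by
    ext i j
    fin_cases i <;> fin_cases j
    exacts [deriv_const t η, rfl, rfl, deriv_const t (-η)]
  have hN := Matrix.eta_fin_two (mpdx (AKNSN3 η q r) x t)
  rw [show mpdx (AKNSN3 η q r) x t 0 0 = _ from d₁₁,
    show mpdx (AKNSN3 η q r) x t 0 1 = _ from d₁₂,
    show mpdx (AKNSN3 η q r) x t 1 0 = _ from d₂₁,
    show mpdx (AKNSN3 η q r) x t 1 1 = _ from d₂₂] at hN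
  rw [hM, hN]
  ext i j
  fin_cases i <;> fin_cases j <;> simp [AKNSM, AKNSN3] <;> ring

/-- For smooth `q, r`, the zero curvature equation `∂_t M − ∂_x N₃ + M N₃ − N₃ M = 0` holds
everywhere iff `q_t = q_{xxx} − 6qrq_x` and `r_t = r_{xxx} − 6qrr_x` hold everywhere. -/
theorem AKNS3_zero_curvature_iff (η : ℂ) (q r : ℝ → ℝ → ℂ)
    (hq : ContDiff ℝ (⊤ : ℕ∞) fun p : ℝ × ℝ => q p.1 p.2)
    (hr : ContDiff ℝ (⊤ : ℕ∞) fun p : ℝ × ℝ => r p.1 p.2) :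
    (∀ x t : ℝ,
        mpdt (AKNSM η q r) x t - mpdx (AKNSN3 η q r) x t
            + AKNSM η q r x t * AKNSN3 η q r x t
            - AKNSN3 η q r x t * AKNSM η q r x t = 0)
      ↔ (∀ x t : ℝ,
          pdt q x t = pdx (pdx (pdx q)) x t - 6 * q x t * r x t * pdx q x t ∧
          pdt r x t = pdx (pdx (pdx r)) x t - 6 * q x t * r x t * pdx r x t) := by
  refine forall₂_congr fun x t => ?_
  rw [AKNS3_zero_curvature_eq η q r x t (hq.slice_left t) (hr.slice_left t),
    ← sub_eq_zero (a := pdt q x t), ← sub_eq_zero (a := pdt r x t)]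
  simp [← Matrix.ext_iff, Fin.forall_fin_two]
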